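/- arXiv:2309.14840 — 7 statements merged into one kernel-verified Lean document; each statement's English description precedes it below -/
import Mathlib

section
/- Let M be any set of natural numbers contained in T, and let A be a finite subset of M with |A| = n. Then the number of elements of M that can be written as a + b + c with a, b, c ∈ A and a < b < c is at most A111384(n) = C(n,3) − C(⌊n/2⌋,3) − C(⌈n/2⌉,3). -/
/-- `T := {3} ∪ {m ∈ ℕ : 3 ∤ m}`. -/
def T : Set ℕ := {3} ∪ {m : ℕ | ¬ (3 ∣ m)}

/-- `S_M(A) := {s ∈ M : ∃ a, b, c ∈ A, a < b < c, s = a + b + c}`. -/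
def SM (M : Set ℕ) (A : Finset ℕ) : Set ℕ :=
  {s ∈ M | ∃ a ∈ A, ∃ b ∈ A, ∃ c ∈ A, a < b ∧ b < c ∧ s = a + b + c}

/-- `A111384(n) = C(n,3) − C(⌊n/2⌋,3) − C(⌈n/2⌉,3)`. -/
def A111384 (n : ℕ) : ℕ := n.choose 3 - (n / 2).choose 3 - ((n + 1) / 2).choose 3

theorem aux_conv (d : ℕ) : ∀ p : ℕ, ((p + (p + d)) / 2).choose 3 + ((p + (p + d) + 1) / 2).choose 3
    ≤ p.choose 3 + (p + d).choose 3 := by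
  induction d using Nat.strong_induction_on with
  | _ d ih =>
    intro p
    match d, ih with
    | 0, _ =>
      have h1 : (p + (p + 0)) / 2 = p := by omega
      have h2 : (p + (p + 0) + 1) / 2 = p := by omega
      rw [h1, h2]; simp
    | 1, _ =>
      have h1 : (p + (p + 1)) / 2 = p := by omega
      have h2 : (p + (p + 1) + 1) / 2 = p + 1 := by omega
      rw [h1, h2]
    | d + 2, ih =>
      have h := ih d (by omega) (p + 1)
      have e : p + 1 + (p + 1 + d) = p + (p + (d + 2)) := by ring
      rw [e] at h
      have h1 : (p + 1).choose 3 = p.choose 2 + p.choose 3 := Nat.choose_succ_succ p 2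
      have h2 : (p + (d + 2)).choose 3 = (p + 1 + d).choose 2 + (p + 1 + d).choose 3 := by
        have : p + (d + 2) = (p + 1 + d) + 1 := by ring
        rw [this]; exact Nat.choose_succ_succ _ 2
      have h3 : p.choose 2 ≤ (p + 1 + d).choose 2 := Nat.choose_le_choose 2 (by omega)
      omega

theorem aux_conv' (p q n : ℕ) (h : p + q = n) : (n / 2).choose 3 + ((n + 1) / 2).choose 3
    ≤ p.choose 3 + q.choose 3 := by
  subst h
  rcases le_total p q with h | h
  · obtain ⟨d, rfl⟩ := Nat.exists_eq_add_of_le h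
    exact aux_conv d p
  · obtain ⟨d, rfl⟩ := Nat.exists_eq_add_of_le h
    have := aux_conv d q
    rw [add_comm q (q + d)] at this
    omega

theorem aux_three (p q n : ℕ) (h : p + q + 1 = n) : (n / 2).choose 3 + ((n + 1) / 2).choose 3
    ≤ p.choose 3 + q.choose 3 + p * q := by
  have key : ∀ a b : ℕ, a ≤ b → a.choose 2 ≤ a * b := by
    intro a b hab
    rw [Nat.choose_two_right]
    calc a * (a - 1) / 2 ≤ a * (a - 1) := Nat.div_le_self _ _
      _ ≤ a * b := Nat.mul_le_mul_left _ (by omega)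
  have succ3 : ∀ a : ℕ, (a + 1).choose 3 = a.choose 2 + a.choose 3 :=
    fun a => Nat.choose_succ_succ a 2
  rcases le_total p q with hpq | hpq
  · have := aux_conv' (p + 1) q n (by omega)
    have := key p q hpq
    have := succ3 p
    omega
  · have := aux_conv' p (q + 1) n (by omega)
    have := key q p hpq
    have := succ3 q
    have := mul_comm p q
    omega

/-- If every element is `≡ r` mod 3, three of them sum to a multiple of 3. -/
theorem aux_sum (B : Finset ℕ) (r : ℕ) (t : Finset ℕ) (hB : ∀ x ∈ B, x % 3 = r)
    (ht : t ∈ B.powersetCard 3) : 3 ∣ ∑ x ∈ t, x := by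
  rw [Finset.mem_powersetCard] at ht
  obtain ⟨x, y, z, hxy, hxz, hyz, rfl⟩ := Finset.card_eq_three.mp ht.2
  have hx := hB x (ht.1 (by simp))
  have hy := hB y (ht.1 (by simp))
  have hz := hB z (ht.1 (by simp))
  rw [Finset.sum_insert (by simp [hxy, hxz]), Finset.sum_pair hyz]
  omega

theorem stmt_0 (M : Set ℕ) (hM : M ⊆ T) (A : Finset ℕ) (hA : ↑A ⊆ M) (n : ℕ)
    (hcard : A.card = n) : (SM M A).ncard ≤ A111384 n := by
  have hT : ∀ x ∈ A, x = 3 ∨ ¬ 3 ∣ x := by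
    intro x hx
    have := hM (hA hx)
    simpa [T] using this
  set G := (A.powersetCard 3).filter (fun t => ¬ 3 ∣ ∑ x ∈ t, x) with hG
  set B := (A.powersetCard 3).filter (fun t => 3 ∣ ∑ x ∈ t, x) with hBdef
  have hsub : SM M A ⊆ ↑(G.image (fun t => ∑ x ∈ t, x)) := by
    rintro s ⟨hsM, a, ha, b, hb, c, hc, hab, hbc, rfl⟩
    have hs : a + b + c = 3 ∨ ¬ 3 ∣ a + b + c := by simpa [T] using hM hsM
    have ha0 := hT a ha
    have hsum : ∑ x ∈ ({a, b, c} : Finset ℕ), x = a + b + c := by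
      rw [Finset.sum_insert (by simp; omega), Finset.sum_pair (by omega)]; ring
    rw [Finset.coe_image]
    refine ⟨{a, b, c}, ?_, hsum⟩
    rw [Finset.mem_coe, hG, Finset.mem_filter, Finset.mem_powersetCard, hsum]
    refine ⟨⟨?_, ?_⟩, ?_⟩
    · intro x hx
      simp only [Finset.mem_insert, Finset.mem_singleton] at hx
      rcases hx with rfl | rfl | rfl <;> assumption
    · exact Finset.card_eq_three.mpr ⟨a, b, c, by omega, by omega, by omega, rfl⟩
    · omega
  have h1 : (SM M A).ncard ≤ G.card := by
    calc (SM M A).ncard ≤ (↑(G.image (fun t => ∑ x ∈ t, x)) : Set ℕ).ncard :=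
          Set.ncard_le_ncard hsub (Finset.finite_toSet _)
      _ = (G.image (fun t => ∑ x ∈ t, x)).card := Set.ncard_coe_finset _
      _ ≤ G.card := Finset.card_image_le
  have h2 : B.card + G.card = n.choose 3 := by
    rw [hBdef, hG, Finset.card_filter_add_card_filter_not, Finset.card_powersetCard, hcard]
  set P := A.filter (fun x => x % 3 = 1) with hP
  set Q := A.filter (fun x => x % 3 = 2) with hQ
  set Z := A.filter (fun x => x = 3) with hZ
  have hPm : ∀ x ∈ P, x % 3 = 1 := fun x hx => (Finset.mem_filter.mp hx).2
  have hQm : ∀ x ∈ Q, x % 3 = 2 := fun x hx => (Finset.mem_filter.mp hx).2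
  have hPA : P ⊆ A := Finset.filter_subset _ _
  have hQA : Q ⊆ A := Finset.filter_subset _ _
  have hPB : P.powersetCard 3 ⊆ B := fun t ht => by
    rw [hBdef, Finset.mem_filter]
    exact ⟨Finset.powersetCard_mono hPA ht, aux_sum P 1 t hPm ht⟩
  have hQB : Q.powersetCard 3 ⊆ B := fun t ht => by
    rw [hBdef, Finset.mem_filter]
    exact ⟨Finset.powersetCard_mono hQA ht, aux_sum Q 2 t hQm ht⟩
  have hdisj : Disjoint (P.powersetCard 3) (Q.powersetCard 3) := by
    rw [Finset.disjoint_left]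
    intro t ht ht'
    rw [Finset.mem_powersetCard] at ht ht'
    obtain ⟨x, hx⟩ : t.Nonempty := Finset.card_pos.mp (by omega)
    have := hPm x (ht.1 hx)
    have := hQm x (ht'.1 hx)
    omega
  have hAu : A = (P ∪ Q) ∪ Z := by
    ext x
    simp only [hP, hQ, hZ, Finset.mem_union, Finset.mem_filter]
    constructor
    · intro hx
      have := hT x hx
      have : x % 3 = 1 ∨ x % 3 = 2 ∨ x = 3 := by omega
      tauto
    · tauto
  have hPQ : Disjoint P Q := by
    rw [Finset.disjoint_left]
    intro x hx hx'
    have := hPm x hx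
    have := hQm x hx'
    omega
  have hPQZ : Disjoint (P ∪ Q) Z := by
    rw [Finset.disjoint_left]
    intro x hx hx'
    have h3 : x = 3 := (Finset.mem_filter.mp hx').2
    rcases Finset.mem_union.mp hx with h | h
    · have := hPm x h; omega
    · have := hQm x h; omega
  have hn : P.card + Q.card + Z.card = n := by
    rw [← hcard, ← Finset.card_union_of_disjoint hPQ, ← Finset.card_union_of_disjoint hPQZ, ← hAu]
  have hPQc : (P.powersetCard 3 ∪ Q.powersetCard 3).card = P.card.choose 3 + Q.card.choose 3 := by
    rw [Finset.card_union_of_disjoint hdisj, Finset.card_powersetCard, Finset.card_powersetCard]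
  have hmain : (n / 2).choose 3 + ((n + 1) / 2).choose 3 ≤ B.card := by
    by_cases h3 : 3 ∈ A
    · have hZ1 : Z = {3} := by
        ext x
        simp only [hZ, Finset.mem_filter, Finset.mem_singleton]
        constructor
        · exact fun h => h.2
        · rintro rfl; exact ⟨h3, rfl⟩
      rw [hZ1, Finset.card_singleton] at hn
      set R := (P ×ˢ Q).image (fun xy => ({3, xy.1, xy.2} : Finset ℕ)) with hR
      have hRc : R.card = P.card * Q.card := by
        rw [hR, Finset.card_image_of_injOn, Finset.card_product]
        rintro ⟨x, y⟩ hxy ⟨x', y'⟩ hxy' heq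
        simp only [Finset.coe_product, Set.mem_prod, Finset.mem_coe] at hxy hxy'
        have a1 := hPm x hxy.1
        have a2 := hQm y hxy.2
        have a3 := hPm x' hxy'.1
        have a4 := hQm y' hxy'.2
        have heq' : ({3, x, y} : Finset ℕ) = {3, x', y'} := heq
        have b1 : x ∈ ({3, x', y'} : Finset ℕ) := by rw [← heq']; simp
        have b2 : y ∈ ({3, x', y'} : Finset ℕ) := by rw [← heq']; simp
        simp only [Finset.mem_insert, Finset.mem_singleton] at b1 b2
        have c1 : x = x' := by omega
        have c2 : y = y' := by omega
        rw [c1, c2]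
      have hRB : R ⊆ B := by
        intro t ht
        obtain ⟨⟨x, y⟩, hxy, rfl⟩ := Finset.mem_image.mp ht
        rw [Finset.mem_product] at hxy
        have a1 : x % 3 = 1 := hPm x hxy.1
        have a2 : y % 3 = 2 := hQm y hxy.2
        have m1 : x ∈ A := hPA hxy.1
        have m2 : y ∈ A := hQA hxy.2
        rw [hBdef, Finset.mem_filter, Finset.mem_powersetCard]
        refine ⟨⟨?_, ?_⟩, ?_⟩
        · intro z hz
          simp only [Finset.mem_insert, Finset.mem_singleton] at hz
          rcases hz with rfl | rfl | rfl <;> assumption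
        · exact Finset.card_eq_three.mpr ⟨3, x, y, by omega, by omega, by omega, rfl⟩
        · show 3 ∣ ∑ z ∈ ({3, x, y} : Finset ℕ), z
          rw [Finset.sum_insert (by simp; omega), Finset.sum_pair (by omega)]
          omega
      have hRd : Disjoint (P.powersetCard 3 ∪ Q.powersetCard 3) R := by
        rw [Finset.disjoint_left]
        intro t ht ht'
        obtain ⟨⟨x, y⟩, hxy, rfl⟩ := Finset.mem_image.mp ht'
        rw [Finset.mem_union, Finset.mem_powersetCard, Finset.mem_powersetCard] at ht
        rcases ht with h | h
        · have := hPm 3 (h.1 (by simp)); omega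
        · have := hQm 3 (h.1 (by simp)); omega
      have hle := Finset.card_le_card (Finset.union_subset (Finset.union_subset hPB hQB) hRB)
      rw [Finset.card_union_of_disjoint hRd, hPQc, hRc] at hle
      exact (aux_three _ _ n hn).trans hle
    · have hZ0 : Z = ∅ := by
        rw [hZ, Finset.filter_eq_empty_iff]
        rintro x hx rfl
        exact h3 hx
      rw [hZ0, Finset.card_empty] at hn
      have hle := Finset.card_le_card (Finset.union_subset hPB hQB)
      rw [hPQc] at hle
      exact (aux_conv' P.card Q.card n hn).trans hle
  unfold A111384
  omega
end

section
/- For every natural number n there exists a finite subset A of T with |A| = n such that the number of elements of T that can be written as a + b + c with a, b, c ∈ A and a < b < c equals A111384(n) = C(n,3) − C(⌊n/2⌋,3) − C(⌈n/2⌉,3). -/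
lemma cardE (n : ℕ) : ((Finset.range n).filter (fun i => i % 2 = 0)).card = (n + 1) / 2 := by
  induction n with
  | zero => rfl
  | succ k ih =>
    rw [Finset.range_add_one, Finset.filter_insert]
    split_ifs with h
    · rw [Finset.card_insert_of_notMem (by simp), ih]; omega
    · rw [ih]; omega

lemma cardO (n : ℕ) : ((Finset.range n).filter (fun i => i % 2 = 1)).card = n / 2 := by
  induction n with
  | zero => rfl
  | succ k ih =>
    rw [Finset.range_add_one, Finset.filter_insert]
    split_ifs with h
    · rw [Finset.card_insert_of_notMem (by simp), ih]; omega
    · rw [ih]; omega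

lemma pow_mod (i : ℕ) : 2 ^ i % 3 = 1 + i % 2 := by
  induction i with
  | zero => rfl
  | succ k ih => rw [pow_succ]; rcases Nat.mod_two_eq_zero_or_one k with h | h <;> omega

theorem stmt_1 (n : ℕ) :
    ∃ A : Finset ℕ, ↑A ⊆ T ∧ A.card = n ∧ (SM T A).ncard = A111384 n := by
  classical
  have inj : Function.Injective (fun i : ℕ => 2 ^ i) := Nat.pow_right_injective le_rfl
  refine ⟨(Finset.range n).image (fun i => 2 ^ i), ?_, ?_, ?_⟩
  · intro x hx
    simp only [Finset.coe_image, Set.mem_image] at hx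
    obtain ⟨i, -, rfl⟩ := hx
    right
    have := pow_mod i
    simp only [Set.mem_ofPred_eq]
    omega
  · rw [Finset.card_image_of_injective _ inj, Finset.card_range]
  · set E := (Finset.range n).filter (fun i => i % 2 = 0) with hE
    set O := (Finset.range n).filter (fun i => i % 2 = 1) with hO
    have key : SM T ((Finset.range n).image (fun i => 2 ^ i)) =
        ↑(((Finset.powersetCard 3 (Finset.range n) \ Finset.powersetCard 3 E) \
          Finset.powersetCard 3 O).image (fun s => ∑ i ∈ s, 2 ^ i)) := by
      ext s
      simp only [SM, T, Finset.coe_image, Set.mem_image, Finset.mem_coe, Finset.mem_sdiff,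
        Finset.mem_powersetCard, Finset.mem_image, Set.mem_ofPred_eq]
      constructor
      · rintro ⟨hs, a, ⟨i, hi, rfl⟩, b, ⟨j, hj, rfl⟩, c, ⟨k, hk, rfl⟩, hab, hbc, rfl⟩
        have hij : i < j := (Nat.pow_lt_pow_iff_right (by norm_num)).1 hab
        have hjk : j < k := (Nat.pow_lt_pow_iff_right (by norm_num)).1 hbc
        have hc : ({i, j, k} : Finset ℕ).card = 3 :=
          Finset.card_eq_three.2 ⟨i, j, k, by omega, by omega, by omega, rfl⟩
        have h1 := pow_mod i
        have h2 := pow_mod j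
        have h3 := pow_mod k
        have h0 : 0 < 2 ^ i := by positivity
        have hs' : ¬ 3 ∣ 2 ^ i + 2 ^ j + 2 ^ k := by
          rcases hs with hs | hs
          · simp only [Set.mem_singleton_iff] at hs; omega
          · exact hs
        refine ⟨{i, j, k}, ⟨⟨⟨?_, hc⟩, ?_⟩, ?_⟩, ?_⟩
        · intro x hx
          simp only [Finset.mem_insert, Finset.mem_singleton] at hx
          rcases hx with rfl | rfl | rfl <;> assumption
        · rintro ⟨h, -⟩
          have a1 := (Finset.mem_filter.1 (h (show i ∈ _ by simp))).2
          have a2 := (Finset.mem_filter.1 (h (show j ∈ _ by simp))).2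
          have a3 := (Finset.mem_filter.1 (h (show k ∈ _ by simp))).2
          omega
        · rintro ⟨h, -⟩
          have a1 := (Finset.mem_filter.1 (h (show i ∈ _ by simp))).2
          have a2 := (Finset.mem_filter.1 (h (show j ∈ _ by simp))).2
          have a3 := (Finset.mem_filter.1 (h (show k ∈ _ by simp))).2
          omega
        · rw [Finset.sum_insert (by simp; omega), Finset.sum_insert (by simp; omega),
            Finset.sum_singleton]
          ring
      · rintro ⟨t, ⟨⟨⟨ht, hc⟩, h1⟩, h2⟩, rfl⟩
        have hord : ∃ i j k, i < j ∧ j < k ∧ t = {i, j, k} := by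
          let f := t.orderEmbOfFin hc
          refine ⟨f 0, f 1, f 2, f.strictMono (by decide), f.strictMono (by decide), ?_⟩
          have := Finset.image_orderEmbOfFin_univ t hc
          refine this.symm.trans ?_
          have hu : (Finset.univ : Finset (Fin 3)) = {0, 1, 2} := by decide
          rw [hu, Finset.image_insert, Finset.image_insert, Finset.image_singleton]
        obtain ⟨i, j, k, hij, hjk, rfl⟩ := hord
        have e : ∑ x ∈ ({i, j, k} : Finset ℕ), 2 ^ x = 2 ^ i + 2 ^ j + 2 ^ k := by
          rw [Finset.sum_insert (by simp; omega), Finset.sum_insert (by simp; omega),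
            Finset.sum_singleton]
          ring
        have hi : i ∈ Finset.range n := ht (by simp)
        have hj : j ∈ Finset.range n := ht (by simp)
        have hk : k ∈ Finset.range n := ht (by simp)
        rw [e]
        refine ⟨Or.inr ?_, _, ⟨i, hi, rfl⟩, _, ⟨j, hj, rfl⟩, _, ⟨k, hk, rfl⟩,
          Nat.pow_lt_pow_right (by norm_num) hij, Nat.pow_lt_pow_right (by norm_num) hjk, rfl⟩
        have p1 := pow_mod i
        have p2 := pow_mod j
        have p3 := pow_mod k
        intro hd
        have hpar : (i % 2 = 0 ∧ j % 2 = 0 ∧ k % 2 = 0) ∨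
            (i % 2 = 1 ∧ j % 2 = 1 ∧ k % 2 = 1) := by omega
        rcases hpar with ⟨q1, q2, q3⟩ | ⟨q1, q2, q3⟩
        · refine h1 ⟨?_, hc⟩
          intro x hx
          rw [hE, Finset.mem_filter]
          refine ⟨ht hx, ?_⟩
          simp only [Finset.mem_insert, Finset.mem_singleton] at hx
          rcases hx with rfl | rfl | rfl <;> assumption
        · refine h2 ⟨?_, hc⟩
          intro x hx
          rw [hO, Finset.mem_filter]
          refine ⟨ht hx, ?_⟩
          simp only [Finset.mem_insert, Finset.mem_singleton] at hx
          rcases hx with rfl | rfl | rfl <;> assumption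
    rw [key, Set.ncard_coe_finset,
      Finset.card_image_of_injective _ (Finset.geomSum_injective le_rfl),
      Finset.card_sdiff_of_subset, Finset.card_sdiff_of_subset, Finset.card_powersetCard,
      Finset.card_powersetCard, Finset.card_powersetCard, cardE, cardO, Finset.card_range,
      A111384]
    · omega
    · exact Finset.powersetCard_mono (Finset.filter_subset _ _)
    · intro s hs
      rw [Finset.mem_sdiff]
      refine ⟨Finset.powersetCard_mono (Finset.filter_subset _ _) hs, ?_⟩
      intro h
      rw [Finset.mem_powersetCard] at hs h
      obtain ⟨x, hx⟩ := Finset.card_pos.1 (by omega : 0 < s.card)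
      have a1 := (Finset.mem_filter.1 (hs.1 hx)).2
      have a2 := (Finset.mem_filter.1 (h.1 hx)).2
      omega
end

section
/- Let A be a finite set of prime numbers with |A| = n. Then the number of primes that can be written as a + b + c with a, b, c ∈ A and a < b < c is at most A111384(n) = C(n,3) − C(⌊n/2⌋,3) − C(⌈n/2⌉,3). -/
/-- `S_P(A) := {s : s prime, ∃ a, b, c ∈ A, a < b < c, s = a + b + c}`. -/
def SP (A : Finset ℕ) : Set ℕ :=
  {s | s.Prime ∧ ∃ a ∈ A, ∃ b ∈ A, ∃ c ∈ A, a < b ∧ b < c ∧ s = a + b + c}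

lemma choose_step (m k : ℕ) (h : m ≤ k) :
    (m + 1).choose 3 + k.choose 3 ≤ m.choose 3 + (k + 1).choose 3 := by
  have h1 := Nat.choose_succ_succ m 2
  have h2 := Nat.choose_succ_succ k 2
  have h3 := Nat.choose_le_choose 2 h
  simp only [Nat.succ_eq_add_one] at h1 h2
  norm_num at h1 h2
  omega

lemma choose_bal (d : ℕ) : ∀ x y : ℕ, x ≤ y → y - x ≤ d →
    ((x + y) / 2).choose 3 + ((x + y + 1) / 2).choose 3 ≤ x.choose 3 + y.choose 3 := by
  induction d with
  | zero =>
    intro x y h1 h2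
    obtain rfl : x = y := by omega
    rw [show (x + x) / 2 = x by omega, show (x + x + 1) / 2 = x by omega]
  | succ d ih =>
    intro x y h1 h2
    by_cases h : y ≤ x + 1
    · rw [show (x + y) / 2 = x by omega, show (x + y + 1) / 2 = y by omega]
    · obtain ⟨z, rfl⟩ : ∃ z, y = z + 1 := ⟨y - 1, by omega⟩
      have h3 := ih (x + 1) z (by omega) (by omega)
      have h4 := choose_step x z (by omega)
      rw [show x + 1 + z = x + (z + 1) by omega] at h3
      omega

lemma choose_bal' (x y : ℕ) :
    ((x + y) / 2).choose 3 + ((x + y + 1) / 2).choose 3 ≤ x.choose 3 + y.choose 3 := by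
  rcases le_total x y with h | h
  · exact choose_bal _ x y h le_rfl
  · have := choose_bal _ y x h le_rfl
    rw [add_comm y x] at this
    omega

lemma choose_bal3 (x y : ℕ) :
    ((x + y + 1) / 2).choose 3 + ((x + y + 1 + 1) / 2).choose 3
      ≤ x.choose 3 + y.choose 3 + x * y := by
  wlog h : x ≤ y generalizing x y with H
  · have := H y x (by omega)
    rw [add_comm y x, mul_comm y x] at this
    omega
  have h1 := Nat.choose_succ_succ x 2
  simp only [Nat.succ_eq_add_one] at h1
  norm_num at h1
  have h2 := choose_bal' (x + 1) y
  rw [show x + 1 + y = x + y + 1 by omega] at h2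
  have h3 : x.choose 2 ≤ x * y := by
    calc x.choose 2 ≤ x ^ 2 := Nat.choose_le_pow x 2
      _ = x * x := sq x
      _ ≤ x * y := Nat.mul_le_mul_left x h
  omega

/-- A family of triples whose sums are all divisible by three bounds the count. -/
lemma key (A : Finset ℕ) (hA : ∀ p ∈ A, p.Prime) (B : Finset (Finset ℕ))
    (hB : B ⊆ A.powersetCard 3) (hd : ∀ S ∈ B, 3 ∣ ∑ i ∈ S, i) :
    (SP A).ncard + B.card ≤ A.card.choose 3 := by
  set G := (A.powersetCard 3).filter (fun S => (∑ i ∈ S, i).Prime) with hG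
  have h1 : SP A ⊆ ((G.image (fun S => ∑ i ∈ S, i) : Finset ℕ) : Set ℕ) := by
    rintro s ⟨hs, a, ha, b, hb, c, hc, hab, hbc, rfl⟩
    have hsum : ∑ i ∈ ({a, b, c} : Finset ℕ), i = a + b + c := by
      rw [Finset.sum_insert, Finset.sum_pair hbc.ne, add_assoc]
      simp only [Finset.mem_insert, Finset.mem_singleton]
      omega
    simp only [Finset.coe_image, Set.mem_image, Finset.mem_coe]
    refine ⟨{a, b, c}, ?_, hsum⟩
    rw [hG, Finset.mem_filter, Finset.mem_powersetCard, hsum]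
    refine ⟨⟨?_, ?_⟩, hs⟩
    · intro i hi
      simp only [Finset.mem_insert, Finset.mem_singleton] at hi
      rcases hi with rfl | rfl | rfl <;> assumption
    · exact Finset.card_eq_three.2 ⟨a, b, c, hab.ne, (hab.trans hbc).ne, hbc.ne, rfl⟩
  have h2 : (SP A).ncard ≤ G.card := by
    calc (SP A).ncard ≤ _ := Set.ncard_le_ncard h1 (Finset.finite_toSet _)
      _ = _ := Set.ncard_coe_finset _
      _ ≤ _ := Finset.card_image_le
  have h3 : Disjoint G B := by
    rw [Finset.disjoint_left]
    intro S hS hSB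
    rw [hG, Finset.mem_filter, Finset.mem_powersetCard] at hS
    obtain ⟨⟨hSA, hc⟩, hp⟩ := hS
    have h6 : S.card • 2 ≤ ∑ i ∈ S, i :=
      Finset.card_nsmul_le_sum S _ 2 (fun i hi => (hA i (hSA hi)).two_le)
    rw [hc] at h6
    have := (Nat.prime_dvd_prime_iff_eq Nat.prime_three hp).1 (hd S hSB)
    rw [← this] at h6
    norm_num at h6
  have h4 : G ∪ B ⊆ A.powersetCard 3 :=
    Finset.union_subset (Finset.filter_subset _ _) hB
  have h5 := Finset.card_le_card h4
  rw [Finset.card_union_of_disjoint h3, Finset.card_powersetCard] at h5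
  omega

lemma mono_dvd (X S : Finset ℕ) (r : ℕ) (hX : ∀ i ∈ X, i % 3 = r)
    (hS : S ∈ X.powersetCard 3) : 3 ∣ ∑ i ∈ S, i := by
  rw [Finset.mem_powersetCard] at hS
  obtain ⟨hSX, hc⟩ := hS
  obtain ⟨a, b, c, hab, hac, hbc, rfl⟩ := Finset.card_eq_three.1 hc
  have ha := hX a (hSX (by simp))
  have hb := hX b (hSX (by simp))
  have hc := hX c (hSX (by simp))
  rw [Finset.sum_insert (by simp [hab, hac]), Finset.sum_pair hbc]
  omega

theorem stmt_2 (A : Finset ℕ) (hA : ∀ p ∈ A, p.Prime) (n : ℕ) (hcard : A.card = n) :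
    (SP A).ncard ≤ A111384 n := by
  set X := A.filter (fun i => i % 3 = 1) with hX
  set Y := A.filter (fun i => i % 3 = 2) with hY
  set Z := A.filter (fun i => i = 3) with hZ
  have hXA : X ⊆ A := Finset.filter_subset _ _
  have hYA : Y ⊆ A := Finset.filter_subset _ _
  have mX : ∀ i ∈ X, i % 3 = 1 := fun i hi => (Finset.mem_filter.1 hi).2
  have mY : ∀ i ∈ Y, i % 3 = 2 := fun i hi => (Finset.mem_filter.1 hi).2
  have hAeq : A = X ∪ Y ∪ Z := by
    ext i
    simp only [hX, hY, hZ, Finset.mem_union, Finset.mem_filter]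
    constructor
    · intro hi
      have : i % 3 = 1 ∨ i % 3 = 2 ∨ i = 3 := by
        by_cases h : i % 3 = 0
        · have := (Nat.prime_dvd_prime_iff_eq Nat.prime_three (hA i hi)).1
            (Nat.dvd_of_mod_eq_zero h)
          omega
        · omega
      tauto
    · tauto
  have hXY : Disjoint X Y := by
    rw [Finset.disjoint_left]
    intro i h1 h2
    have := mX i h1
    have := mY i h2
    omega
  have hXYZ : Disjoint (X ∪ Y) Z := by
    rw [Finset.disjoint_left]
    intro i h1 h2
    have h3 := (Finset.mem_filter.1 h2).2
    rcases Finset.mem_union.1 h1 with h | h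
    · have := mX i h
      omega
    · have := mY i h
      omega
  have hn : n = X.card + Y.card + Z.card := by
    rw [← hcard, ← Finset.card_union_of_disjoint hXY, ← Finset.card_union_of_disjoint hXYZ,
      ← hAeq]
  set B0 := X.powersetCard 3 ∪ Y.powersetCard 3 with hB0
  have hB0A : B0 ⊆ A.powersetCard 3 := Finset.union_subset
    (Finset.powersetCard_mono hXA) (Finset.powersetCard_mono hYA)
  have hB0d : ∀ S ∈ B0, 3 ∣ ∑ i ∈ S, i := by
    intro S hS
    rcases Finset.mem_union.1 hS with h | h
    · exact mono_dvd X S 1 mX h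
    · exact mono_dvd Y S 2 mY h
  have hB0c : B0.card = X.card.choose 3 + Y.card.choose 3 := by
    rw [hB0, Finset.card_union_of_disjoint, Finset.card_powersetCard, Finset.card_powersetCard]
    rw [Finset.disjoint_left]
    intro S h1 h2
    rw [Finset.mem_powersetCard] at h1 h2
    obtain ⟨i, hi⟩ : S.Nonempty := Finset.card_pos.1 (by omega)
    exact Finset.disjoint_left.1 hXY (h1.1 hi) (h2.1 hi)
  by_cases h3 : 3 ∈ A
  · have hZc : Z.card = 1 := by
      rw [hZ, Finset.filter_eq' A 3, if_pos h3, Finset.card_singleton]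
    set B1 := (X ×ˢ Y).image (fun p => ({3, p.1, p.2} : Finset ℕ)) with hB1
    have hB1c : B1.card = X.card * Y.card := by
      rw [hB1, Finset.card_image_of_injOn, Finset.card_product]
      rintro ⟨a, b⟩ h1 ⟨c, d⟩ h2 h
      simp only [Finset.mem_coe, Finset.mem_product] at h1 h2
      simp only at h
      have e1 := mX a h1.1
      have e2 := mY b h1.2
      have e3 := mX c h2.1
      have e4 := mY d h2.2
      have f1 : a ∈ ({3, c, d} : Finset ℕ) := by rw [← h]; simp
      have f2 : b ∈ ({3, c, d} : Finset ℕ) := by rw [← h]; simp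
      simp only [Finset.mem_insert, Finset.mem_singleton] at f1 f2
      rw [Prod.mk.injEq]
      constructor <;> omega
    have hdis : Disjoint B0 B1 := by
      rw [Finset.disjoint_left]
      intro S h1 h2
      obtain ⟨p, hp, rfl⟩ := Finset.mem_image.1 h2
      rcases Finset.mem_union.1 h1 with h | h
      · have := mX 3 ((Finset.mem_powersetCard.1 h).1 (by simp))
        omega
      · have := mY 3 ((Finset.mem_powersetCard.1 h).1 (by simp))
        omega
    have hk := key A hA (B0 ∪ B1) ?_ ?_
    · rw [Finset.card_union_of_disjoint hdis, hB0c, hB1c, hcard] at hk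
      have hb := choose_bal3 X.card Y.card
      rw [hZc] at hn
      rw [← hn] at hb
      unfold A111384
      omega
    · refine Finset.union_subset hB0A ?_
      intro S hS
      obtain ⟨⟨a, b⟩, hp, rfl⟩ := Finset.mem_image.1 hS
      rw [Finset.mem_product] at hp
      have e1 := mX a hp.1
      have e2 := mY b hp.2
      rw [Finset.mem_powersetCard]
      refine ⟨?_, Finset.card_eq_three.2 ⟨3, a, b, by omega, by omega, by omega, rfl⟩⟩
      intro i hi
      simp only [Finset.mem_insert, Finset.mem_singleton] at hi
      rcases hi with rfl | rfl | rfl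
      · exact h3
      · exact hXA hp.1
      · exact hYA hp.2
    · intro S hS
      rcases Finset.mem_union.1 hS with h | h
      · exact hB0d S h
      · obtain ⟨⟨a, b⟩, hp, rfl⟩ := Finset.mem_image.1 h
        rw [Finset.mem_product] at hp
        have e1 := mX a hp.1
        have e2 := mY b hp.2
        simp only at e1 e2 ⊢
        rw [Finset.sum_insert, Finset.sum_pair (by omega)]
        · omega
        · simp only [Finset.mem_insert, Finset.mem_singleton]
          omega
  · have hZc : Z.card = 0 := by
      rw [hZ, Finset.filter_eq' A 3, if_neg h3, Finset.card_empty]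
    have hk := key A hA B0 hB0A hB0d
    rw [hB0c, hcard] at hk
    have hb := choose_bal' X.card Y.card
    rw [hZc, add_zero] at hn
    rw [← hn] at hb
    unfold A111384
    omega
end

section
/- Let M ⊆ T and let A ⊆ M be a finite set with 3 ∉ A and |A| = n. Let α₁ := |{a ∈ A : a ≡ 1 (mod 3)}| and α₂ := |{a ∈ A : a ≡ 2 (mod 3)}|. Then the number of elements of M that can be written as a + b + c with a, b, c ∈ A and a < b < c is at most C(n,3) − C(α₁,3) − C(α₂,3). -/
theorem stmt_11 (M : Set ℕ) (hM : M ⊆ T) (A : Finset ℕ) (hA : ↑A ⊆ M)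
    (h3 : 3 ∉ A) (n : ℕ) (hcard : A.card = n)
    (α₁ α₂ : ℕ) (hα₁ : α₁ = (A.filter (fun a => a % 3 = 1)).card)
    (hα₂ : α₂ = (A.filter (fun a => a % 3 = 2)).card) :
    (SM M A).ncard ≤ n.choose 3 - α₁.choose 3 - α₂.choose 3 := by
  classical
  set A1 := A.filter (fun a => a % 3 = 1) with hA1
  set A2 := A.filter (fun a => a % 3 = 2) with hA2
  have hsub1 : Finset.powersetCard 3 A1 ⊆ Finset.powersetCard 3 A :=
    Finset.powersetCard_mono (Finset.filter_subset _ _)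
  have hsub2 : Finset.powersetCard 3 A2 ⊆ Finset.powersetCard 3 A :=
    Finset.powersetCard_mono (Finset.filter_subset _ _)
  have hdisj : Disjoint (Finset.powersetCard 3 A1) (Finset.powersetCard 3 A2) := by
    rw [Finset.disjoint_left]
    intro s hs1 hs2
    rw [Finset.mem_powersetCard] at hs1 hs2
    have hne : s.Nonempty := by
      rw [← Finset.card_pos]; omega
    obtain ⟨x, hx⟩ := hne
    have h1 := (Finset.mem_filter.mp (hs1.1 hx)).2
    have h2 := (Finset.mem_filter.mp (hs2.1 hx)).2
    omega
  set P := Finset.powersetCard 3 A \ (Finset.powersetCard 3 A1 ∪ Finset.powersetCard 3 A2) with hP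
  have hPcard : P.card = n.choose 3 - α₁.choose 3 - α₂.choose 3 := by
    rw [hP, Finset.card_sdiff_of_subset (Finset.union_subset hsub1 hsub2),
      Finset.card_union_of_disjoint hdisj, Finset.card_powersetCard, Finset.card_powersetCard,
      Finset.card_powersetCard, hcard, ← hα₁, ← hα₂, Nat.sub_sub]
  have himg : SM M A ⊆ ↑(P.image (fun s => ∑ x ∈ s, x)) := by
    rintro s ⟨hsM, a, ha, b, hb, c, hc, hab, hbc, rfl⟩
    have hT : a + b + c = 3 ∨ ¬ (3 ∣ a + b + c) := by
      simpa [T] using hM hsM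
    rw [Finset.mem_coe, Finset.mem_image]
    refine ⟨{a, b, c}, ?_, ?_⟩
    · rw [hP, Finset.mem_sdiff, Finset.mem_union, Finset.mem_powersetCard,
        Finset.mem_powersetCard, Finset.mem_powersetCard]
      refine ⟨⟨?_, ?_⟩, ?_⟩
      · intro x hx
        simp only [Finset.mem_insert, Finset.mem_singleton] at hx
        rcases hx with rfl | rfl | rfl <;> assumption
      · exact Finset.card_eq_three.mpr ⟨a, b, c, by omega, by omega, by omega, rfl⟩
      · rintro (h | h)
        all_goals
          have h1 := (Finset.mem_filter.mp (h.1 (show a ∈ ({a, b, c} : Finset ℕ) by simp))).2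
          have h2 := (Finset.mem_filter.mp (h.1 (show b ∈ ({a, b, c} : Finset ℕ) by simp))).2
          have h3 := (Finset.mem_filter.mp (h.1 (show c ∈ ({a, b, c} : Finset ℕ) by simp))).2
          omega
    · have hnb : a ∉ ({b, c} : Finset ℕ) := by
        simp only [Finset.mem_insert, Finset.mem_singleton]; omega
      rw [Finset.sum_insert hnb, Finset.sum_pair (by omega)]
      omega
  calc (SM M A).ncard ≤ (↑(P.image (fun s => ∑ x ∈ s, x)) : Set ℕ).ncard :=
        Set.ncard_le_ncard himg (Finset.finite_toSet _)
    _ = (P.image (fun s => ∑ x ∈ s, x)).card := Set.ncard_coe_finset _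
    _ ≤ P.card := Finset.card_image_le
    _ = _ := hPcard
end

section
/- Let M ⊆ T and let A ⊆ M be a finite set with 3 ∈ A. Let α₁ := |{a ∈ A : a ≡ 1 (mod 3)}| and α₂ := |{a ∈ A : a ≡ 2 (mod 3)}|. Then |S_M(A)| ≤ |S_M(A \ {3})| + C(α₁,2) + C(α₂,2). -/
theorem aux_pair (A : Finset ℕ) (r x y : ℕ) (hx : x ∈ A) (hy : y ∈ A) (hxy : x ≠ y)
    (h1 : x % 3 = r) (h2 : y % 3 = r) :
    3 + x + y ∈ ((A.filter (fun a => a % 3 = r)).powersetCard 2).image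
      (fun P => 3 + ∑ p ∈ P, p) := by
  rw [Finset.mem_image]
  refine ⟨{x, y}, ?_, ?_⟩
  · rw [Finset.mem_powersetCard]
    refine ⟨?_, Finset.card_pair hxy⟩
    intro z hz
    simp only [Finset.mem_insert, Finset.mem_singleton] at hz
    rw [Finset.mem_filter]
    rcases hz with rfl | rfl
    · exact ⟨hx, h1⟩
    · exact ⟨hy, h2⟩
  · simp only [Finset.sum_pair hxy]
    omega

theorem aux_finite (M : Set ℕ) (A : Finset ℕ) : (SM M A).Finite := by
  refine (Set.finite_Iic (3 * A.sup id)).subset ?_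
  rintro s ⟨-, a, ha, b, hb, c, hc, -, -, rfl⟩
  have h1 : a ≤ A.sup id := Finset.le_sup (f := id) ha
  have h2 : b ≤ A.sup id := Finset.le_sup (f := id) hb
  have h3 : c ≤ A.sup id := Finset.le_sup (f := id) hc
  simp only [Set.mem_Iic]
  omega

theorem stmt_12 (M : Set ℕ) (hM : M ⊆ T) (A : Finset ℕ) (hA : ↑A ⊆ M)
    (h3 : 3 ∈ A)
    (α₁ α₂ : ℕ) (hα₁ : α₁ = (A.filter (fun a => a % 3 = 1)).card)
    (hα₂ : α₂ = (A.filter (fun a => a % 3 = 2)).card) :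
    (SM M A).ncard ≤ (SM M (A.erase 3)).ncard + α₁.choose 2 + α₂.choose 2 := by
  classical
  let I : ℕ → Finset ℕ := fun r =>
    ((A.filter (fun a => a % 3 = r)).powersetCard 2).image (fun P => 3 + ∑ p ∈ P, p)
  have hI : ∀ r, (I r).card ≤ (A.filter (fun a => a % 3 = r)).card.choose 2 := by
    intro r
    refine Finset.card_image_le.trans ?_
    rw [Finset.card_powersetCard]
  have hT : ∀ x ∈ A, x = 3 ∨ x % 3 ≠ 0 := by
    intro x hx
    rcases hM (hA hx) with h | h
    · exact Or.inl h
    · right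
      intro h0
      exact h (Nat.dvd_of_mod_eq_zero h0)
  have key : ∀ x ∈ A, ∀ y ∈ A, x ≠ y → x ≠ 3 → y ≠ 3 → 3 + x + y ∈ M →
      3 + x + y ∈ I 1 ∨ 3 + x + y ∈ I 2 := by
    intro x hx y hy hxy hx3 hy3 hs
    have h1 := hT x hx
    have h2 := hT y hy
    have h4 : (3 + x + y) % 3 ≠ 0 := by
      rcases hM hs with h | h
      · have h : 3 + x + y = 3 := h
        omega
      · intro h0
        exact h (Nat.dvd_of_mod_eq_zero h0)
    have h5 : (x % 3 = 1 ∧ y % 3 = 1) ∨ (x % 3 = 2 ∧ y % 3 = 2) := by omega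
    rcases h5 with ⟨h5, h6⟩ | ⟨h5, h6⟩
    · exact Or.inl (aux_pair A 1 x y hx hy hxy h5 h6)
    · exact Or.inr (aux_pair A 2 x y hx hy hxy h5 h6)
  have hsub : SM M A ⊆ (SM M (A.erase 3) ∪ ↑(I 1)) ∪ ↑(I 2) := by
    rintro s ⟨hs, a, ha, b, hb, c, hc, hab, hbc, rfl⟩
    have fin : ∀ x y, 3 + x + y = a + b + c → (3 + x + y ∈ I 1 ∨ 3 + x + y ∈ I 2) →
        a + b + c ∈ (SM M (A.erase 3) ∪ ↑(I 1)) ∪ (↑(I 2) : Set ℕ) := by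
      intro x y e h
      rw [e] at h
      rcases h with h | h
      · exact Or.inl (Or.inr h)
      · exact Or.inr h
    by_cases ha3 : a = 3
    · have e : 3 + b + c = a + b + c := by omega
      exact fin b c e (key b hb c hc (by omega) (by omega) (by omega) (e ▸ hs))
    by_cases hb3 : b = 3
    · have e : 3 + a + c = a + b + c := by omega
      exact fin a c e (key a ha c hc (by omega) (by omega) (by omega) (e ▸ hs))
    by_cases hc3 : c = 3
    · have e : 3 + a + b = a + b + c := by omega
      exact fin a b e (key a ha b hb (by omega) (by omega) (by omega) (e ▸ hs))
    exact Or.inl (Or.inl ⟨hs, a, Finset.mem_erase.2 ⟨ha3, ha⟩, b, Finset.mem_erase.2 ⟨hb3, hb⟩,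
      c, Finset.mem_erase.2 ⟨hc3, hc⟩, hab, hbc, rfl⟩)
  have hfin : ((SM M (A.erase 3) ∪ ↑(I 1)) ∪ (↑(I 2) : Set ℕ)).Finite :=
    ((aux_finite M _).union (Finset.finite_toSet _)).union (Finset.finite_toSet _)
  have h1 := Set.ncard_le_ncard hsub hfin
  have h2 := Set.ncard_union_le (SM M (A.erase 3) ∪ ↑(I 1)) (↑(I 2) : Set ℕ)
  have h4 := Set.ncard_union_le (SM M (A.erase 3)) (↑(I 1) : Set ℕ)
  rw [Set.ncard_coe_finset] at h2 h4
  have h5 := hI 1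
  have h6 := hI 2
  rw [hα₁, hα₂]
  omega
end

section
/- Define a_k := 3^{k+1} + 1 if k is odd and a_k := 3^{k+1} + 2 if k is even, for k ≥ 1. Then for all indices i < j < k and i' < j' < k' (all ≥ 1), if a_i + a_j + a_k = a_{i'} + a_{j'} + a_{k'} then (i, j, k) = (i', j', k'). In other words, the sums of three distinct elements of {a_1, a_2, a_3, …} are pairwise distinct. -/
/-- `a_k := 3^(k+1) + 1` for odd `k`, `a_k := 3^(k+1) + 2` for even `k`. -/
def aSeq (k : ℕ) : ℕ := if Odd k then 3 ^ (k + 1) + 1 else 3 ^ (k + 1) + 2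

lemma aSeq_double {m n : ℕ} (hm : 1 ≤ m) (h : m < n) : 2 * aSeq m < aSeq n := by
  have h1 : 3 ^ (m + 1 + 1) ≤ 3 ^ (n + 1) := Nat.pow_le_pow_right (by norm_num) (by omega)
  have h2 : 3 ^ (1 + 1) ≤ 3 ^ (m + 1) := Nat.pow_le_pow_right (by norm_num) (by omega)
  rw [pow_succ 3 (m + 1)] at h1
  unfold aSeq
  split_ifs <;> omega

theorem stmt_13 (i j k i' j' k' : ℕ)
    (hi : 1 ≤ i) (hij : i < j) (hjk : j < k)
    (hi' : 1 ≤ i') (hij' : i' < j') (hjk' : j' < k')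
    (hsum : aSeq i + aSeq j + aSeq k = aSeq i' + aSeq j' + aSeq k') :
    i = i' ∧ j = j' ∧ k = k' := by
  have a1 := aSeq_double hi hij
  have a2 := aSeq_double (by omega) hjk
  have b1 := aSeq_double hi' hij'
  have b2 := aSeq_double (by omega) hjk'
  have hk : k = k' := by
    rcases lt_trichotomy k k' with h | h | h
    · have := aSeq_double (by omega) h
      omega
    · exact h
    · have := aSeq_double (by omega) h
      omega
  subst hk
  have hj : j = j' := by
    rcases lt_trichotomy j j' with h | h | h
    · have := aSeq_double (by omega) h
      omega
    · exact h
    · have := aSeq_double (by omega) h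
      omega
  subst hj
  refine ⟨?_, rfl, rfl⟩
  rcases lt_trichotomy i i' with h | h | h
  · have := aSeq_double (by omega) h
    omega
  · exact h
  · have := aSeq_double (by omega) h
    omega
end

section
/- Define a_k := 3^{k+1} + 1 if k is odd and a_k := 3^{k+1} + 2 if k is even, and for n ∈ ℕ let A_n := {a_1, …, a_n}. Then A_n ⊆ T, the a_k are pairwise distinct (so |A_n| = n), and the number of elements of T that can be written as a + b + c with a, b, c ∈ A_n and a < b < c equals A111384(n) = C(n,3) − C(⌊n/2⌋,3) − C(⌈n/2⌉,3). -/
/-- `A_n := {a_1, …, a_n}`. -/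
def ASet (n : ℕ) : Finset ℕ := (Finset.Icc 1 n).image aSeq

theorem aSeq_two_mul (k : ℕ) : 2 * aSeq k ≤ aSeq (k + 1) := by
  have h : 1 ≤ 3 ^ k := Nat.one_le_pow _ _ (by norm_num)
  unfold aSeq
  split_ifs <;> simp only [pow_succ] <;> omega

theorem aSeq_pos (k : ℕ) : 0 < aSeq k := by
  unfold aSeq
  split_ifs <;> exact Nat.succ_pos _

theorem aSeq_strictMono : StrictMono aSeq :=
  strictMono_nat_of_lt_succ fun k => by
    have := aSeq_two_mul k
    have := aSeq_pos k
    omega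

theorem aSeq_sum_lt (k : ℕ) : ∑ i ∈ Finset.range k, aSeq i < aSeq k := by
  induction k with
  | zero => simpa using aSeq_pos 0
  | succ k ih =>
    rw [Finset.sum_range_succ]
    have := aSeq_two_mul k
    omega

theorem aSeq_sum_lt_of_subset {k : ℕ} {s : Finset ℕ} (hs : s ⊆ Finset.range k) :
    ∑ i ∈ s, aSeq i < aSeq k :=
  lt_of_le_of_lt (Finset.sum_le_sum_of_subset hs) (aSeq_sum_lt k)

theorem aSeq_sum_inj (k : ℕ) : ∀ s t : Finset ℕ, s ⊆ Finset.range k → t ⊆ Finset.range k →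
    ∑ i ∈ s, aSeq i = ∑ i ∈ t, aSeq i → s = t := by
  induction k with
  | zero =>
    intro s t hs ht _
    simp at hs ht
    rw [hs, ht]
  | succ k ih =>
    have key : ∀ s : Finset ℕ, s ⊆ Finset.range (k + 1) → s.erase k ⊆ Finset.range k := by
      intro s hs x hx
      have h1 := Finset.mem_erase.1 hx
      have h2 := Finset.mem_range.1 (hs h1.2)
      rw [Finset.mem_range]
      omega
    have dec : ∀ s : Finset ℕ, s ⊆ Finset.range (k + 1) → k ∉ s →
        ∑ i ∈ s, aSeq i < aSeq k := by
      intro s hs hk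
      have := key s hs
      rw [Finset.erase_eq_of_notMem hk] at this
      exact aSeq_sum_lt_of_subset this
    intro s t hs ht h
    by_cases h1 : k ∈ s <;> by_cases h2 : k ∈ t
    · rw [← Finset.add_sum_erase s aSeq h1, ← Finset.add_sum_erase t aSeq h2] at h
      have := ih _ _ (key s hs) (key t ht) (by omega)
      rw [← Finset.insert_erase h1, ← Finset.insert_erase h2, this]
    · have := dec t ht h2
      rw [← Finset.add_sum_erase s aSeq h1] at h
      omega
    · have := dec s hs h1
      rw [← Finset.add_sum_erase t aSeq h2] at h
      omega
    · have a := key s hs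
      have b := key t ht
      rw [Finset.erase_eq_of_notMem h1] at a
      rw [Finset.erase_eq_of_notMem h2] at b
      exact ih s t a b h

theorem aSeq_mod (k : ℕ) : (Odd k ∧ aSeq k % 3 = 1) ∨ (Even k ∧ aSeq k % 3 = 2) := by
  unfold aSeq
  split_ifs with h
  · left
    refine ⟨h, ?_⟩
    rw [pow_succ]; omega
  · right
    refine ⟨Nat.not_odd_iff_even.1 h, ?_⟩
    rw [pow_succ]; omega

theorem card_filter_even (n : ℕ) : ((Finset.Icc 1 n).filter Even).card = n / 2 ∧
    ((Finset.Icc 1 n).filter Odd).card = (n + 1) / 2 := by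
  induction n with
  | zero => simp
  | succ n ih =>
    rw [← Finset.insert_Icc_right_eq_Icc_add_one (by omega : 1 ≤ n + 1), Finset.filter_insert,
      Finset.filter_insert]
    rcases Nat.even_or_odd (n + 1) with h | h
    · have h' : ¬ Odd (n + 1) := Nat.not_odd_iff_even.2 h
      rw [if_pos h, if_neg h', Finset.card_insert_of_notMem (by simp), ih.1, ih.2]
      rw [Nat.even_iff] at h
      omega
    · have h' : ¬ Even (n + 1) := Nat.not_even_iff_odd.2 h
      rw [if_pos h, if_neg h', Finset.card_insert_of_notMem (by simp), ih.1, ih.2]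
      rw [Nat.odd_iff] at h
      omega

theorem sorted_triple (t : Finset ℕ) (h : t.card = 3) :
    ∃ x y z, x < y ∧ y < z ∧ t = {x, y, z} := by
  obtain ⟨x, y, z, hxy, hxz, hyz, rfl⟩ := Finset.card_eq_three.1 h
  have e : ∀ a b c : ℕ, a ∈ ({x, y, z} : Finset ℕ) → b ∈ ({x, y, z} : Finset ℕ) →
      c ∈ ({x, y, z} : Finset ℕ) → a < b → b < c →
      ∃ x' y' z', x' < y' ∧ y' < z' ∧ ({x, y, z} : Finset ℕ) = {x', y', z'} := by
    intro a b c ha hb hc hab hbc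
    refine ⟨a, b, c, hab, hbc, ?_⟩
    ext w
    simp only [Finset.mem_insert, Finset.mem_singleton] at *
    omega
  rcases lt_or_gt_of_ne hxy with h1 | h1 <;> rcases lt_or_gt_of_ne hxz with h2 | h2 <;>
    rcases lt_or_gt_of_ne hyz with h3 | h3
  · exact e x y z (by simp) (by simp) (by simp) h1 h3
  · exact e x z y (by simp) (by simp) (by simp) h2 h3
  · omega
  · exact e z x y (by simp) (by simp) (by simp) h2 h1
  · exact e y x z (by simp) (by simp) (by simp) h1 h2
  · omega
  · exact e y z x (by simp) (by simp) (by simp) h3 h2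
  · exact e z y x (by simp) (by simp) (by simp) h3 h1

theorem sum_triple {x y z : ℕ} (h1 : x < y) (h2 : y < z) :
    ∑ i ∈ ({x, y, z} : Finset ℕ), aSeq i = aSeq x + aSeq y + aSeq z := by
  rw [Finset.sum_insert (by simp; omega), Finset.sum_insert (by simp; omega),
    Finset.sum_singleton, add_assoc]

theorem SM_eq (n : ℕ) : SM T (ASet n) =
    ↑((((Finset.Icc 1 n).powersetCard 3).filter (fun t => ¬ 3 ∣ ∑ i ∈ t, aSeq i)).image
      (fun t => ∑ i ∈ t, aSeq i)) := by
  ext s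
  simp only [SM, ASet, Set.mem_ofPred_eq, Finset.coe_image, Set.mem_image, Finset.mem_coe,
    Finset.mem_filter, Finset.mem_powersetCard, Finset.mem_image]
  constructor
  · rintro ⟨hT, _, ⟨x, hx, rfl⟩, _, ⟨y, hy, rfl⟩, _, ⟨z, hz, rfl⟩, hxy, hyz, rfl⟩
    have h1 := aSeq_strictMono.lt_iff_lt.1 hxy
    have h2 := aSeq_strictMono.lt_iff_lt.1 hyz
    refine ⟨{x, y, z}, ⟨⟨?_, ?_⟩, ?_⟩, sum_triple h1 h2⟩
    · intro w hw
      simp only [Finset.mem_insert, Finset.mem_singleton] at hw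
      rcases hw with rfl | rfl | rfl <;> assumption
    · exact Finset.card_eq_three.2 ⟨x, y, z, by omega, by omega, by omega, rfl⟩
    · rw [sum_triple h1 h2]
      rcases hT with hT | hT
      · have := aSeq_pos x
        simp only [Set.mem_singleton_iff] at hT
        omega
      · exact hT
  · rintro ⟨t, ⟨⟨hsub, hc⟩, hd⟩, rfl⟩
    obtain ⟨x, y, z, h1, h2, rfl⟩ := sorted_triple t hc
    refine ⟨Or.inr hd, _, ⟨x, hsub (by simp), rfl⟩, _, ⟨y, hsub (by simp), rfl⟩, _,
      ⟨z, hsub (by simp), rfl⟩, aSeq_strictMono h1, aSeq_strictMono h2, sum_triple h1 h2⟩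

theorem filter_dvd (n : ℕ) :
    ((Finset.Icc 1 n).powersetCard 3).filter (fun t => 3 ∣ ∑ i ∈ t, aSeq i) =
    ((Finset.Icc 1 n).filter Even).powersetCard 3 ∪
      ((Finset.Icc 1 n).filter Odd).powersetCard 3 := by
  ext t
  simp only [Finset.mem_filter, Finset.mem_powersetCard, Finset.mem_union]
  by_cases hc : t.card = 3
  · obtain ⟨x, y, z, h1, h2, rfl⟩ := sorted_triple t hc
    rw [sum_triple h1 h2]
    simp only [hc, and_true, Finset.insert_subset_iff, Finset.singleton_subset_iff,
      Finset.mem_filter]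
    have hx := aSeq_mod x
    have hy := aSeq_mod y
    have hz := aSeq_mod z
    simp only [Nat.even_iff, Nat.odd_iff] at *
    have key : 3 ∣ aSeq x + aSeq y + aSeq z ↔
        (x % 2 = 0 ∧ y % 2 = 0 ∧ z % 2 = 0) ∨ (x % 2 = 1 ∧ y % 2 = 1 ∧ z % 2 = 1) := by
      omega
    rw [key]
    constructor
    · rintro ⟨⟨a, b, c⟩, ⟨d, e, f⟩ | ⟨d, e, f⟩⟩
      · exact Or.inl ⟨⟨a, d⟩, ⟨b, e⟩, ⟨c, f⟩⟩
      · exact Or.inr ⟨⟨a, d⟩, ⟨b, e⟩, ⟨c, f⟩⟩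
    · rintro (⟨⟨a, d⟩, ⟨b, e⟩, ⟨c, f⟩⟩ | ⟨⟨a, d⟩, ⟨b, e⟩, ⟨c, f⟩⟩)
      · exact ⟨⟨a, b, c⟩, Or.inl ⟨d, e, f⟩⟩
      · exact ⟨⟨a, b, c⟩, Or.inr ⟨d, e, f⟩⟩
  · simp [hc]

theorem card_SM (n : ℕ) : (SM T (ASet n)).ncard = A111384 n := by
  rw [SM_eq, Set.ncard_coe_finset, Finset.card_image_of_injOn]
  · have h := Finset.card_filter_add_card_filter_not (s := (Finset.Icc 1 n).powersetCard 3)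
      (fun t => 3 ∣ ∑ i ∈ t, aSeq i)
    rw [filter_dvd, Finset.card_union_of_disjoint, Finset.card_powersetCard,
      Finset.card_powersetCard, Finset.card_powersetCard, (card_filter_even n).1,
      (card_filter_even n).2, Nat.card_Icc, Nat.add_sub_cancel] at h
    · unfold A111384
      omega
    · rw [Finset.disjoint_left]
      intro t h1 h2
      rw [Finset.mem_powersetCard] at h1 h2
      obtain ⟨x, hx⟩ : t.Nonempty := Finset.card_pos.1 (by omega)
      have a := (Finset.mem_filter.1 (h1.1 hx)).2
      have b := (Finset.mem_filter.1 (h2.1 hx)).2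
      exact Nat.not_odd_iff_even.2 a b
  · intro s hs t ht h
    have sub : Finset.Icc 1 n ⊆ Finset.range (n + 1) := by
      intro x hx
      simp at hx ⊢
      omega
    simp only [Finset.mem_coe, Finset.mem_filter, Finset.mem_powersetCard] at hs ht
    exact aSeq_sum_inj (n + 1) s t (hs.1.1.trans sub) (ht.1.1.trans sub) h

theorem stmt_14 (n : ℕ) :
    ↑(ASet n) ⊆ T ∧
      (∀ i j : ℕ, 1 ≤ i → 1 ≤ j → aSeq i = aSeq j → i = j) ∧
      (ASet n).card = n ∧
      (SM T (ASet n)).ncard = A111384 n := by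
  refine ⟨?_, fun i j _ _ h => aSeq_strictMono.injective h, ?_, card_SM n⟩
  · intro x hx
    simp only [ASet, Finset.coe_image, Set.mem_image] at hx
    obtain ⟨k, _, rfl⟩ := hx
    right
    have := aSeq_mod k
    simp only [Set.mem_ofPred_eq]
    omega
  · rw [ASet, Finset.card_image_of_injective _ aSeq_strictMono.injective]
    simp
end
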